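/- arXiv:math/0306362 — 2 statements merged into one kernel-verified Lean document; each statement's English description precedes it below -/
import Mathlib

section
/- Let α be any 2-form on ℝ⁷ and c ∈ ℝ. If α∧α = c·Φ, then c = 0. -/
open scoped BigOperators

/-- The generalized Kronecker/Levi-Civita epsilon symbol on `Fin 7`. -/
noncomputable def eps (v : Fin 7 → Fin 7) : ℝ :=
  if h : Function.Bijective v then ((Equiv.Perm.sign (Equiv.ofBijective v h) : ℤ) : ℝ) else 0

/-- The basis monomial form `e_{I 0} ∧ ⋯ ∧ e_{I (p-1)}`, given by its components. -/
noncomputable def mono {p : ℕ} (I : Fin p → Fin 7) : (Fin p → Fin 7) → ℝ :=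
  fun v => Matrix.det (Matrix.of fun a b => if I a = v b then (1 : ℝ) else 0)

/-- A (componentwise) `p`-form: totally antisymmetric in its indices. -/
def IsForm {p : ℕ} (c : (Fin p → Fin 7) → ℝ) : Prop :=
  (∀ v : Fin p → Fin 7, ¬ Function.Injective v → c v = 0) ∧
  (∀ (v : Fin p → Fin 7) (σ : Equiv.Perm (Fin p)),
    c (v ∘ σ) = ((Equiv.Perm.sign σ : ℤ) : ℝ) * c v)

/-- Wedge product of forms, in components. -/
noncomputable def wedge {p q : ℕ} (a : (Fin p → Fin 7) → ℝ) (b : (Fin q → Fin 7) → ℝ) :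
    (Fin (p + q) → Fin 7) → ℝ := fun v =>
  (1 / ((Nat.factorial p : ℝ) * (Nat.factorial q : ℝ))) *
    ∑ σ : Equiv.Perm (Fin (p + q)),
      ((Equiv.Perm.sign σ : ℤ) : ℝ) *
        a (fun i => v (σ (Fin.castAdd q i))) * b (fun j => v (σ (Fin.natAdd p j)))

/-- The Hodge star operator (standard metric and orientation on ℝ⁷), in components. -/
noncomputable def hstar {p q : ℕ} (h : p + q = 7) (a : (Fin p → Fin 7) → ℝ) :
    (Fin q → Fin 7) → ℝ := fun w =>
  (1 / (Nat.factorial p : ℝ)) *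
    ∑ v : Fin p → Fin 7, a v * eps (fun i => Fin.append v w (Fin.cast h.symm i))

/-- The fundamental 3-form ω = e₁₂₄+e₂₃₅+e₃₄₆+e₄₅₇+e₅₆₁+e₆₇₂+e₇₁₃ (indices shifted to 0,…,6). -/
noncomputable def ω : (Fin 3 → Fin 7) → ℝ :=
  mono ![0, 1, 3] + mono ![1, 2, 4] + mono ![2, 3, 5] + mono ![3, 4, 6] +
    mono ![4, 5, 0] + mono ![5, 6, 1] + mono ![6, 0, 2]

/-- The 4-form Φ = −e₃₅₆₇−e₄₆₇₁−e₅₇₁₂−e₆₁₂₃−e₇₂₃₄−e₁₃₄₅−e₂₄₅₆ (indices shifted to 0,…,6). -/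
noncomputable def Φ : (Fin 4 → Fin 7) → ℝ :=
  -mono ![2, 4, 5, 6] - mono ![3, 5, 6, 0] - mono ![4, 6, 0, 1] - mono ![5, 0, 1, 2] -
    mono ![6, 1, 2, 3] - mono ![0, 2, 3, 4] - mono ![1, 3, 4, 5]

/-- Components ω_{ijk}. -/
noncomputable def ω3 (i j k : Fin 7) : ℝ := ω ![i, j, k]

/-- Components ω_{ijkl} = Φ(e_i,e_j,e_k,e_l). -/
noncomputable def ω4 (i j k l : Fin 7) : ℝ := Φ ![i, j, k, l]

/-- Kronecker delta. -/
def δ (i j : Fin 7) : ℝ := if i = j then 1 else 0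

/-- Components of a 2-form. -/
def c2 (a : (Fin 2 → Fin 7) → ℝ) (i j : Fin 7) : ℝ := a ![i, j]

/-- The operator α ↦ ⋆(α ∧ ω) on 2-forms. -/
noncomputable def Lω (a : (Fin 2 → Fin 7) → ℝ) : (Fin 2 → Fin 7) → ℝ :=
  hstar (p := 5) (q := 2) rfl (wedge a ω)

/-- The integer-valued version of `mono`. -/
def monoInt {p : ℕ} (I v : Fin p → Fin 7) : ℤ :=
  Matrix.det (Matrix.of fun a b => if I a = v b then (1 : ℤ) else 0)

theorem mono_eq_intCast {p : ℕ} (I v : Fin p → Fin 7) : mono I v = (monoInt I v : ℝ) := by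
  unfold mono monoInt
  refine Eq.trans ?_ (RingHom.map_det (Int.castRingHom ℝ) _).symm
  congr 1
  ext a b
  simp [apply_ite]

/-- The integer-valued version of `Φ`. -/
def PhiInt (v : Fin 4 → Fin 7) : ℤ :=
  -monoInt ![2, 4, 5, 6] v - monoInt ![3, 5, 6, 0] v - monoInt ![4, 6, 0, 1] v -
    monoInt ![5, 0, 1, 2] v - monoInt ![6, 1, 2, 3] v - monoInt ![0, 2, 3, 4] v -
    monoInt ![1, 3, 4, 5] v

theorem Phi_eq_intCast (v : Fin 4 → Fin 7) : Φ v = (PhiInt v : ℝ) := by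
  simp [Φ, PhiInt, mono_eq_intCast]

/-- For each index `l` there is a triple of indices that only `l` completes to a nonzero
component of `Φ`. -/
theorem PhiInt_update (l m : Fin 7) :
    PhiInt (Function.update ![l + 3, l + 5, l + 6, 0] 3 m) ≠ 0 ↔ m = l := by
  revert l m
  decide +kernel

/-- An antisymmetric real matrix of size 7 has a nontrivial kernel. -/
theorem exists_mulVec_eq_zero_of_transpose_eq_neg (A : Matrix (Fin 7) (Fin 7) ℝ)
    (hA : A.transpose = -A) : ∃ x : Fin 7 → ℝ, x ≠ 0 ∧ A.mulVec x = 0 := by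
  rw [Matrix.exists_mulVec_eq_zero_iff]
  have h := Matrix.det_transpose A
  rw [hA, Matrix.det_neg, Fintype.card_fin] at h
  linarith

theorem IsForm.apply_swap {α : (Fin 2 → Fin 7) → ℝ} (hα : IsForm α) (i j : Fin 7) :
    α ![j, i] = -α ![i, j] := by
  have h := hα.2 ![i, j] (Equiv.swap 0 1)
  have e : (![i, j] : Fin 2 → Fin 7) ∘ Equiv.swap (0 : Fin 2) 1 = ![j, i] := by
    ext k; fin_cases k <;> simp
  rw [e, Equiv.Perm.sign_swap (by decide)] at h
  simpa using h

/-- Contracting `α ∧ α` with a vector in the kernel of `α` gives zero. -/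
theorem sum_mul_wedge_self_update_eq_zero {α : (Fin 2 → Fin 7) → ℝ} (hα : IsForm α)
    {x : Fin 7 → ℝ} (hx : ∀ i, ∑ l, α ![i, l] * x l = 0) (w : Fin 4 → Fin 7) :
    ∑ l, x l * wedge α α (Function.update w 3 l : Fin (2 + 2) → Fin 7) = 0 := by
  have hx' : ∀ i, ∑ l, α ![l, i] * x l = 0 := fun i => by
    simp only [hα.apply_swap i, neg_mul, Finset.sum_neg_distrib, hx, neg_zero]
  have hpair : ∀ f : Fin 2 → Fin 7, α f = α ![f 0, f 1] := fun f => by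
    congr 1; ext k; fin_cases k <;> rfl
  unfold wedge
  simp only [Finset.mul_sum]
  rw [Finset.sum_comm]
  refine Finset.sum_eq_zero fun σ _ => ?_
  set s : ℝ := ((Equiv.Perm.sign σ : ℤ) : ℝ)
  have hfac : ∀ u : Fin (2 + 2) → Fin 7,
      α (fun i => u (σ (Fin.castAdd 2 i))) * α (fun j => u (σ (Fin.natAdd 2 j))) =
        α ![u (σ 0), u (σ 1)] * α ![u (σ 2), u (σ 3)] := fun u => by
    rw [hpair, hpair (fun j => u (σ (Fin.natAdd 2 j)))]; rfl
  simp only [mul_assoc, hfac]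
  obtain ⟨p, hp⟩ := σ.surjective (3 : Fin (2 + 2))
  have hne : ∀ q, q ≠ p → σ q ≠ 3 := fun q hq h => hq (σ.injective (h.trans hp.symm))
  have hpull : ∀ a b : ℝ, ∀ y : Fin 7 → ℝ, ∑ l, y l * x l = 0 →
      ∑ l, x l * (a * (b * y l)) = 0 := fun a b y hy => by
    rw [← mul_zero (a * b), ← hy, Finset.mul_sum]
    exact Finset.sum_congr rfl fun l _ => by ring
  refine hpull _ _ _ ?_
  have hupd : ∀ q l, Function.update w 3 l (σ q) = if q = p then l else w (σ q) := fun q l => by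
    split_ifs with hq
    · rw [hq, hp, Function.update_self]
    · exact Function.update_of_ne (hne q hq) _ _
  have hleft : ∀ b : ℝ, ∀ i, ∑ l, b * α ![i, l] * x l = 0 := fun b i => by
    simp only [mul_assoc, ← Finset.mul_sum, hx, mul_zero]
  have hright : ∀ b : ℝ, ∀ i, ∑ l, b * α ![l, i] * x l = 0 := fun b i => by
    simp only [mul_assoc, ← Finset.mul_sum, hx', mul_zero]
  simp only [hupd]
  clear hupd hne hp
  fin_cases p
  · simpa [mul_comm] using hright (α ![w (σ 2), w (σ 3)]) (w (σ 1))
  · simpa [mul_comm] using hleft (α ![w (σ 2), w (σ 3)]) (w (σ 0))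
  · simpa using hright (α ![w (σ 0), w (σ 1)]) (w (σ 3))
  · simpa using hleft (α ![w (σ 0), w (σ 1)]) (w (σ 2))

/-- if α is a 2-form with α∧α = c·Φ then c = 0. -/
theorem wedge_square_multiple_of_Phi (α : (Fin 2 → Fin 7) → ℝ) (hα : IsForm α)
    (c : ℝ) (h : wedge α α = c • Φ) : c = 0 := by
  obtain ⟨x, hx0, hx⟩ := exists_mulVec_eq_zero_of_transpose_eq_neg
    (Matrix.of fun i j => α ![i, j]) (by ext i j; simp [hα.apply_swap i j])
  obtain ⟨l, hl⟩ := Function.ne_iff.mp hx0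
  have hsum := sum_mul_wedge_self_update_eq_zero hα (fun i => congrFun hx i)
    ![l + 3, l + 5, l + 6, 0]
  rw [h, Finset.sum_eq_single l] at hsum
  · have hPhi := (PhiInt_update l l).mpr rfl
    simp only [Pi.smul_apply, smul_eq_mul, Phi_eq_intCast] at hsum
    simpa [hPhi, show x l ≠ 0 from hl] using hsum
  · intro m _ hm
    have hPhi := not_not.mp (mt (PhiInt_update l m).mp hm)
    simp [Phi_eq_intCast, hPhi]
  · simp
end

section
/- Let α be a 2-form on ℝ⁷ with ⋆(α∧ω) = α. If there exist c ∈ ℝ and a 1-form β on ℝ⁷ such that α∧α = c·Φ + β∧ω, then α = 0. (Equivalently: if the Λ⁴₂₇-part of α∧α vanishes, then α = 0, where Λ⁴₂₇ is the orthogonal complement in the 4-forms of the span of Φ together with all 4-forms β∧ω with β a 1-form.) -/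
open scoped BigOperators

lemma mono_isForm {p : ℕ} (I : Fin p → Fin 7) : IsForm (mono I) := by
  refine ⟨fun v hv => ?_, fun v σ => ?_⟩
  · obtain ⟨i, j, hij, hne⟩ := Function.not_injective_iff.mp hv
    exact Matrix.det_zero_of_column_eq hne fun k => by simp [hij]
  · exact Matrix.det_permute' σ (Matrix.of fun a b => if I a = v b then (1 : ℝ) else 0)

lemma IsForm.add {p : ℕ} {a b : (Fin p → Fin 7) → ℝ} (ha : IsForm a) (hb : IsForm b) :
    IsForm (a + b) :=
  ⟨fun v hv => by simp [ha.1 v hv, hb.1 v hv],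
    fun v σ => by simp only [Pi.add_apply, ha.2 v σ, hb.2 v σ]; ring⟩

lemma ω_isForm : IsForm ω := by
  unfold ω
  exact (((((((mono_isForm _).add (mono_isForm _)).add (mono_isForm _)).add
    (mono_isForm _)).add (mono_isForm _)).add (mono_isForm _)).add (mono_isForm _))

/-- Summing a monomial form against an alternating function evaluates that function. -/
lemma sum_mono_mul {p : ℕ} (I : Fin p → Fin 7) (f : (Fin p → Fin 7) → ℝ)
    (hf : ∀ v (σ : Equiv.Perm (Fin p)), f (v ∘ σ) = ((Equiv.Perm.sign σ : ℤ) : ℝ) * f v) :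
    ∑ v, mono I v * f v = (p.factorial : ℝ) * f I := by
  have hm : ∀ v, mono I v = ∑ σ : Equiv.Perm (Fin p),
      if I ∘ σ = v then ((Equiv.Perm.sign σ : ℤ) : ℝ) else 0 := by
    intro v
    simp only [mono, Matrix.det_apply', Matrix.of_apply]
    refine Finset.sum_congr rfl fun σ _ => ?_
    by_cases h : I ∘ σ = v
    · subst h; simp
    · obtain ⟨i, hi⟩ := Function.ne_iff.mp h
      rw [if_neg h, Finset.prod_eq_zero (Finset.mem_univ i) (if_neg hi), mul_zero]
  simp only [hm, Finset.sum_mul]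
  rw [Finset.sum_comm]
  simp only [ite_mul, zero_mul, Finset.sum_ite_eq, Finset.mem_univ, if_true, hf]
  simp only [← mul_assoc, ← Int.cast_mul, ← Units.val_mul, Int.units_mul_self]
  simp [Fintype.card_perm]

lemma eps_eq_mono : eps = mono id := by
  funext v
  unfold eps
  split_ifs with h
  · have := (mono_isForm id).2 id (Equiv.ofBijective v h)
    have h1 : mono (id : Fin 7 → Fin 7) id = 1 := by
      have : (Matrix.of fun a b : Fin 7 => if id a = id b then (1 : ℝ) else 0) = 1 := by
        ext a b; simp [Matrix.one_apply]
      rw [mono, this, Matrix.det_one]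
    rw [h1, mul_one] at this
    exact this.symm
  · exact ((mono_isForm id).1 v fun hi => h (Finite.injective_iff_bijective.mp hi)).symm

lemma eps_comp (v : Fin 7 → Fin 7) (σ : Equiv.Perm (Fin 7)) :
    eps (v ∘ σ) = ((Equiv.Perm.sign σ : ℤ) : ℝ) * eps v := by
  rw [eps_eq_mono]; exact (mono_isForm id).2 v σ

/-- The Levi-Civita symbol as a computable product of signs. -/
def signProd (v : Fin 7 → Fin 7) : ℤ :=
  ∏ i : Fin 7, ∏ j ∈ Finset.Ioi i, if v i < v j then 1 else if v i = v j then 0 else -1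

lemma eps_eq_signProd (v : Fin 7 → Fin 7) : eps v = (signProd v : ℝ) := by
  unfold eps signProd
  split_ifs with h
  · rw [Equiv.Perm.sign_eq_prod_prod_Ioi]
    norm_cast
    push_cast
    refine Finset.prod_congr rfl fun i _ => Finset.prod_congr rfl fun j hj => ?_
    have hne : v i ≠ v j := fun e => (Finset.mem_Ioi.mp hj).ne (h.1 e)
    simp only [Equiv.ofBijective_apply, hne, if_false]
    split_ifs <;> rfl
  · have : ¬ Function.Injective v := fun hi => h (Finite.injective_iff_bijective.mp hi)
    obtain ⟨i, j, hij, hne⟩ := Function.not_injective_iff.mp this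
    symm
    norm_cast
    rcases lt_or_gt_of_ne hne with hlt | hlt
    · exact Finset.prod_eq_zero (Finset.mem_univ i)
        (Finset.prod_eq_zero (Finset.mem_Ioi.mpr hlt) (by simp [hij]))
    · exact Finset.prod_eq_zero (Finset.mem_univ j)
        (Finset.prod_eq_zero (Finset.mem_Ioi.mpr hlt) (by simp [hij]))

lemma ω_eq_sum : ω = ∑ i : Fin 7, mono ![i, i + 1, i + 3] := by
  simp only [Fin.sum_univ_seven]
  rfl

/-- Permuting a block of arguments of the Levi-Civita symbol multiplies it by the sign. -/
lemma eps_block {n : ℕ} (e : Fin n ↪ Fin 7) (u v : Fin 7 → Fin 7) (σ : Equiv.Perm (Fin n))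
    (hin : ∀ i, u (e i) = v (e (σ i))) (hout : ∀ k, k ∉ Set.range e → u k = v k) :
    eps u = ((Equiv.Perm.sign σ : ℤ) : ℝ) * eps v := by
  have : u = v ∘ (σ.extendDomain (Equiv.ofInjective e e.injective)) := by
    funext k
    by_cases hk : k ∈ Set.range e
    · obtain ⟨i, rfl⟩ := hk
      have := Equiv.Perm.extendDomain_apply_image σ (Equiv.ofInjective e e.injective) i
      simp only [Equiv.ofInjective_apply] at this
      simp only [Function.comp_apply, this, hin]
    · rw [Function.comp_apply, Equiv.Perm.extendDomain_apply_not_subtype _ _ hk, hout k hk]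
  rw [this, eps_comp, Equiv.Perm.sign_extendDomain]

/-- `⋆(α ∧ ω)` as a contraction of `α` with the Levi-Civita symbol along the lines of the
Fano plane. -/
lemma Lω_apply (a : (Fin 2 → Fin 7) → ℝ) (k l : Fin 7) :
    Lω a ![k, l] = 1 / 2 * ∑ x, ∑ y, a ![x, y] *
      ((∑ i : Fin 7, signProd ![x, y, i, i + 1, i + 3, k, l] : ℤ) : ℝ) := by
  have hsum : ∀ u : Fin 2 → Fin 7, ∑ t : Fin 3 → Fin 7,
      ω t * eps ![u 0, u 1, t 0, t 1, t 2, k, l]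
        = 6 * ((∑ i : Fin 7, signProd ![u 0, u 1, i, i + 1, i + 3, k, l] : ℤ) : ℝ) := by
    intro u
    rw [ω_eq_sum]
    simp only [Finset.sum_apply, Finset.sum_mul]
    rw [Finset.sum_comm, Int.cast_sum, Finset.mul_sum]
    refine Finset.sum_congr rfl fun i _ => ?_
    rw [sum_mono_mul _ (fun t => eps ![u 0, u 1, t 0, t 1, t 2, k, l])]
    · simp [eps_eq_signProd, Nat.factorial]
    · intro t σ
      refine eps_block ⟨![2, 3, 4], by decide⟩ _ _ σ ?_ ?_
      · intro j
        generalize hm : σ j = m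
        fin_cases j <;> fin_cases m <;> simp_all
      · intro m hm
        fin_cases m <;> first
          | rfl
          | exact absurd ⟨0, rfl⟩ hm
          | exact absurd ⟨1, rfl⟩ hm
          | exact absurd ⟨2, rfl⟩ hm
  have hreindex : ∀ σ : Equiv.Perm (Fin (2 + 3)), ∑ v : Fin 5 → Fin 7,
      ((Equiv.Perm.sign σ : ℤ) : ℝ) * a (fun i => v (σ (Fin.castAdd 3 i))) *
        ω (fun j => v (σ (Fin.natAdd 2 j))) * eps ![v 0, v 1, v 2, v 3, v 4, k, l]
      = ∑ v : Fin 5 → Fin 7, a ![v 0, v 1] * ω ![v 2, v 3, v 4] *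
          eps ![v 0, v 1, v 2, v 3, v 4, k, l] := by
    intro σ
    refine Fintype.sum_equiv (Equiv.arrowCongr σ.symm (Equiv.refl _)) _ _ fun v => ?_
    have h1 : eps ![v (σ 0), v (σ 1), v (σ 2), v (σ 3), v (σ 4), k, l]
        = ((Equiv.Perm.sign σ : ℤ) : ℝ) * eps ![v 0, v 1, v 2, v 3, v 4, k, l] := by
      refine eps_block ⟨![0, 1, 2, 3, 4], by decide⟩ _ _ σ ?_ ?_
      · intro j
        generalize hm : σ j = m
        fin_cases j <;> fin_cases m <;> simp_all
      · intro m hm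
        fin_cases m <;> first
          | rfl
          | exact absurd ⟨0, rfl⟩ hm
          | exact absurd ⟨1, rfl⟩ hm
          | exact absurd ⟨2, rfl⟩ hm
          | exact absurd ⟨3, rfl⟩ hm
          | exact absurd ⟨4, rfl⟩ hm
    have h2 : (fun i => v (σ (Fin.castAdd 3 i))) = ![v (σ 0), v (σ 1)] := by
      funext i; fin_cases i <;> rfl
    have h3 : (fun i => v (σ (Fin.natAdd 2 i))) = ![v (σ 2), v (σ 3), v (σ 4)] := by
      funext i; fin_cases i <;> rfl
    simp only [Equiv.arrowCongr_apply, Equiv.coe_refl, Function.comp_apply, id_eq,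
      Equiv.symm_symm]
    rw [h1, h2, h3]
    ring
  have hw : ∀ v : Fin 5 → Fin 7,
      (fun i => Fin.append v ![k, l] (Fin.cast (rfl : 5 + 2 = 7).symm i))
        = ![v 0, v 1, v 2, v 3, v 4, k, l] := by
    intro v; funext i; fin_cases i <;> rfl
  have hsplit : ∑ v : Fin 5 → Fin 7, a ![v 0, v 1] * ω ![v 2, v 3, v 4] *
          eps ![v 0, v 1, v 2, v 3, v 4, k, l]
      = ∑ u : Fin 2 → Fin 7, a u * ∑ t : Fin 3 → Fin 7,
          ω t * eps ![u 0, u 1, t 0, t 1, t 2, k, l] := by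
    simp only [Finset.mul_sum]
    rw [← Fintype.sum_prod_type']
    symm
    refine Fintype.sum_equiv (Fin.appendEquiv 2 3) _ _ fun ⟨u, t⟩ => ?_
    have h2 : u = ![u 0, u 1] := by funext i; fin_cases i <;> rfl
    have h3 : t = ![t 0, t 1, t 2] := by funext i; fin_cases i <;> rfl
    rw [← mul_assoc]
    conv_lhs => rw [h2, h3]
    rfl
  have hmain : Lω a ![k, l] = 1 / 2 * ∑ u : Fin 2 → Fin 7, a u *
      ((∑ i : Fin 7, signProd ![u 0, u 1, i, i + 1, i + 3, k, l] : ℤ) : ℝ) := by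
    simp only [Lω, hstar, wedge, hw]
    simp only [mul_assoc, Finset.sum_mul, ← Finset.mul_sum]
    rw [Finset.sum_comm]
    simp only [← mul_assoc]
    rw [Finset.sum_congr rfl fun σ _ => hreindex σ, hsplit]
    simp only [hsum, Finset.sum_const, Finset.card_univ, Fintype.card_perm, Fintype.card_fin]
    simp only [mul_left_comm _ (6 : ℝ), ← Finset.mul_sum]
    norm_num [Nat.factorial]
    ring
  rw [hmain, ← Fintype.sum_prod_type']
  congr 1
  refine Fintype.sum_equiv (finTwoArrowEquiv (Fin 7)) _ _ fun u => ?_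
  have h2 : u = ![u 0, u 1] := by funext i; fin_cases i <;> rfl
  conv_lhs => rw [h2]
  rfl

lemma IsForm.swap {a : (Fin 2 → Fin 7) → ℝ} (ha : IsForm a) (x y : Fin 7) :
    a ![x, y] = -a ![y, x] := by
  have h := ha.2 ![y, x] (Equiv.swap 0 1)
  have e : ![y, x] ∘ (Equiv.swap (0 : Fin 2) 1) = ![x, y] := by
    funext i; fin_cases i <;> simp
  rw [e] at h
  simpa using h

lemma sum_signProd_line (k x y : Fin 7) :
    ∑ i : Fin 7, signProd ![x, y, i, i + 1, i + 3, k + 1, k + 3]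
      = (if x = k + 6 then if y = k + 2 then 1 else 0 else 0)
        - (if x = k + 2 then if y = k + 6 then 1 else 0 else 0)
        + (if x = k + 5 then if y = k + 4 then 1 else 0 else 0)
        - (if x = k + 4 then if y = k + 5 then 1 else 0 else 0) := by
  revert k x y
  decide +kernel

/-- The defining linear equations of `Λ²₁₄`: the contraction of `α` with `ω` vanishes. -/
lemma contraction_eq_zero {a : (Fin 2 → Fin 7) → ℝ} (ha : IsForm a) (h14 : Lω a = a)
    (k : Fin 7) :
    a ![k + 1, k + 3] + a ![k + 2, k + 6] + a ![k + 4, k + 5] = 0 := by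
  have h := Lω_apply a (k + 1) (k + 3)
  simp only [h14, sum_signProd_line] at h
  push_cast at h
  simp only [mul_add, mul_sub, Finset.sum_add_distrib, Finset.sum_sub_distrib, mul_ite, mul_one,
    mul_zero, Finset.sum_ite_irrel, Finset.sum_const_zero, Finset.sum_ite_eq', Finset.mem_univ,
    if_true] at h
  rw [ha.swap (k + 6), ha.swap (k + 5)] at h
  linarith

lemma Equiv.Perm.sum_decomposeFin {n : ℕ} (f : Equiv.Perm (Fin (n + 1)) → ℝ) :
    ∑ σ, f σ = ∑ i, ∑ τ : Equiv.Perm (Fin n), f (Equiv.Perm.decomposeFin.symm (i, τ)) := by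
  rw [← Equiv.sum_comp Equiv.Perm.decomposeFin.symm, Fintype.sum_prod_type]

/-- The full antisymmetrization of a function of four indices, written out. -/
lemma sum_perm_four (F : Fin 4 → Fin 4 → Fin 4 → Fin 4 → ℝ) :
    ∑ σ : Equiv.Perm (Fin 4),
        ((Equiv.Perm.sign σ : ℤ) : ℝ) * F (σ 0) (σ 1) (σ 2) (σ 3) =
      F 0 1 2 3 - F 0 1 3 2 - F 0 2 1 3 + F 0 2 3 1 + F 0 3 1 2 - F 0 3 2 1
      - F 1 0 2 3 + F 1 0 3 2 + F 1 2 0 3 - F 1 2 3 0 - F 1 3 0 2 + F 1 3 2 0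
      + F 2 0 1 3 - F 2 0 3 1 - F 2 1 0 3 + F 2 1 3 0 + F 2 3 0 1 - F 2 3 1 0
      - F 3 0 1 2 + F 3 0 2 1 + F 3 1 0 2 - F 3 1 2 0 - F 3 2 0 1 + F 3 2 1 0 := by
  have h2 : (2 : Fin 4) = Fin.succ (Fin.succ 0) := rfl
  have h3 : (3 : Fin 4) = Fin.succ (Fin.succ (Fin.succ 0)) := rfl
  have h1 : (1 : Fin 4) = Fin.succ 0 := rfl
  simp only [Equiv.Perm.sum_decomposeFin, Finset.univ_unique, Finset.sum_singleton,
    Fin.sum_univ_succ, h1, h2, h3, Equiv.Perm.decomposeFin_symm_apply_zero,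
    Equiv.Perm.decomposeFin_symm_apply_succ, Equiv.Perm.decomposeFin.symm_sign]
  simp [Equiv.swap_apply_def]
  ring

lemma wedge_self_apply {a : (Fin 2 → Fin 7) → ℝ} (ha : IsForm a) (p q r s : Fin 7) :
    wedge a a ![p, q, r, s] = 2 * (a ![p, q] * a ![r, s] - a ![p, r] * a ![q, s]
      + a ![p, s] * a ![q, r]) := by
  have hc : ∀ u : Fin 2 → Fin 7, a u = a ![u 0, u 1] := fun u => by
    congr 1; funext i; fin_cases i <;> rfl
  obtain ⟨F, hF⟩ : ∃ F : Fin 4 → Fin 4 → Fin 4 → Fin 4 → ℝ, F = fun i j k l =>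
      a ![![p, q, r, s] i, ![p, q, r, s] j] * a ![![p, q, r, s] k, ![p, q, r, s] l] := ⟨_, rfl⟩
  have key : wedge a a ![p, q, r, s] = 1 / 4 * ∑ σ : Equiv.Perm (Fin 4),
      ((Equiv.Perm.sign σ : ℤ) : ℝ) * F (σ 0) (σ 1) (σ 2) (σ 3) := by
    subst hF
    unfold wedge
    congr 1
    · norm_num [Nat.factorial]
    · refine Finset.sum_congr rfl fun σ _ => ?_
      rw [hc (fun i => _), hc (fun i => ![p, q, r, s] (σ (Fin.natAdd 2 i))), mul_assoc]
      rfl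
  rw [key, sum_perm_four, hF]
  simp only [Matrix.cons_val]
  rw [ha.swap q p, ha.swap r p, ha.swap s p, ha.swap r q, ha.swap s q, ha.swap s r]
  ring

lemma wedge_one_three_apply (b : (Fin 1 → Fin 7) → ℝ) {w : (Fin 3 → Fin 7) → ℝ} (hw : IsForm w)
    (p q r s : Fin 7) :
    wedge b w ![p, q, r, s] = b ![p] * w ![q, r, s] - b ![q] * w ![p, r, s]
      + b ![r] * w ![p, q, s] - b ![s] * w ![p, q, r] := by
  have hb : ∀ u : Fin 1 → Fin 7, b u = b ![u 0] := fun u => by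
    congr 1; funext i; fin_cases i; rfl
  have hc : ∀ u : Fin 3 → Fin 7, w u = w ![u 0, u 1, u 2] := fun u => by
    congr 1; funext i; fin_cases i <;> rfl
  have h01 : ∀ x y z, w ![y, x, z] = -w ![x, y, z] := fun x y z => by
    have h := hw.2 ![x, y, z] (Equiv.swap 0 1)
    rw [hc (_ ∘ _)] at h
    simpa [Equiv.swap_apply_def] using h
  have h12 : ∀ x y z, w ![x, z, y] = -w ![x, y, z] := fun x y z => by
    have h := hw.2 ![x, y, z] (Equiv.swap 1 2)
    rw [hc (_ ∘ _)] at h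
    simpa [Equiv.swap_apply_def] using h
  obtain ⟨F, hF⟩ : ∃ F : Fin 4 → Fin 4 → Fin 4 → Fin 4 → ℝ, F = fun i j k l =>
      b ![![p, q, r, s] i] * w ![![p, q, r, s] j, ![p, q, r, s] k, ![p, q, r, s] l] := ⟨_, rfl⟩
  have key : wedge b w ![p, q, r, s] = 1 / 6 * ∑ σ : Equiv.Perm (Fin 4),
      ((Equiv.Perm.sign σ : ℤ) : ℝ) * F (σ 0) (σ 1) (σ 2) (σ 3) := by
    subst hF
    unfold wedge
    congr 1
    · norm_num [Nat.factorial]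
    · refine Fintype.sum_equiv (Equiv.refl (Equiv.Perm (Fin 4))) _ _ fun σ => ?_
      rw [hb (fun i => _), hc (fun i => _), mul_assoc]
      rfl
  have alt : ∀ x y z, w ![y, z, x] = w ![x, y, z] ∧ w ![z, x, y] = w ![x, y, z] ∧
      w ![z, y, x] = -w ![x, y, z] := fun x y z => by
    refine ⟨?_, ?_, ?_⟩
    · rw [h12 y x z, h01 x y z, neg_neg]
    · rw [h01 x z y, h12 x y z, neg_neg]
    · rw [h01 y z x, h12 y x z, h01 x y z, neg_neg]
  rw [key, sum_perm_four, hF]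
  simp only [Matrix.cons_val]
  have e : ∀ x y z, w ![x, z, y] = -w ![x, y, z] ∧ w ![y, x, z] = -w ![x, y, z] ∧
      w ![y, z, x] = w ![x, y, z] ∧ w ![z, x, y] = w ![x, y, z] ∧
      w ![z, y, x] = -w ![x, y, z] := fun x y z => ⟨h12 x y z, h01 x y z, alt x y z⟩
  obtain ⟨a1, a2, a3, a4, a5⟩ := e q r s
  obtain ⟨b1, b2, b3, b4, b5⟩ := e p r s
  obtain ⟨c1, c2, c3, c4, c5⟩ := e p q s
  obtain ⟨d1, d2, d3, d4, d5⟩ := e p q r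
  rw [a1, a2, a3, a4, a5, b1, b2, b3, b4, b5, c1, c2, c3, c4, c5, d1, d2, d3, d4, d5]
  ring

lemma mono_eq_intCast_s16 {p : ℕ} (I v : Fin p → Fin 7) :
    mono I v = ((Matrix.det (Matrix.of fun a b => if I a = v b then (1 : ℤ) else 0) : ℤ) : ℝ) := by
  rw [mono, Int.cast_det]
  congr 1
  ext a b
  simp only [Matrix.map_apply, Matrix.of_apply]
  split_ifs <;> simp

lemma Φ_eq_sum : Φ = -∑ i : Fin 7, mono ![i + 2, i + 4, i + 5, i + 6] := by
  rw [Fin.sum_univ_seven]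
  change _ = -(mono ![2, 4, 5, 6] + mono ![3, 5, 6, 0] + mono ![4, 6, 0, 1] + mono ![5, 0, 1, 2] +
    mono ![6, 1, 2, 3] + mono ![0, 2, 3, 4] + mono ![1, 3, 4, 5])
  unfold Φ
  abel

lemma ω_apply (v : Fin 3 → Fin 7) : ω v = ((∑ i : Fin 7, Matrix.det (Matrix.of fun a b =>
    if ![i, i + 1, i + 3] a = v b then (1 : ℤ) else 0) : ℤ) : ℝ) := by
  rw [ω_eq_sum, Finset.sum_apply, Int.cast_sum]
  exact Finset.sum_congr rfl fun i _ => mono_eq_intCast_s16 _ _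

lemma Φ_apply (v : Fin 4 → Fin 7) : Φ v = ((-∑ i : Fin 7, Matrix.det (Matrix.of fun a b =>
    if ![i + 2, i + 4, i + 5, i + 6] a = v b then (1 : ℤ) else 0) : ℤ) : ℝ) := by
  rw [Φ_eq_sum, Pi.neg_apply, Finset.sum_apply, Int.cast_neg, Int.cast_sum]
  exact congrArg _ (Finset.sum_congr rfl fun i _ => mono_eq_intCast_s16 _ _)

lemma ω_line (i : Fin 7) : ω ![i, i + 1, i + 3] = 1 := by
  rw [ω_apply]
  norm_cast
  revert i
  decide +kernel

lemma ω_off_line (i d : Fin 7) (hd : d = 2 ∨ d = 4 ∨ d = 5 ∨ d = 6) :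
    ω ![i + d, i + 1, i + 3] = 0 ∧ ω ![i + d, i, i + 3] = 0 ∧ ω ![i + d, i, i + 1] = 0 ∧
      Φ ![i + d, i, i + 1, i + 3] = 0 := by
  simp only [ω_apply, Φ_apply]
  norm_cast
  revert i d
  decide +kernel

lemma ω_block (i : Fin 7) :
    ω ![i + 4, i + 5, i + 6] = 0 ∧ ω ![i + 2, i + 5, i + 6] = 0 ∧
      ω ![i + 2, i + 4, i + 6] = 0 ∧ ω ![i + 2, i + 4, i + 5] = 0 ∧
      Φ ![i + 2, i + 4, i + 5, i + 6] = -1 := by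
  simp only [ω_apply, Φ_apply]
  norm_cast
  revert i
  decide +kernel

/-- The quadratic identities satisfied by the components of `α` at the index `0`. -/
lemma row_zero_identities (a : Fin 7 → Fin 7 → ℝ) (b : Fin 7 → ℝ) (c : ℝ)
    (hskew : ∀ x y, a x y = -a y x)
    (hL : ∀ k, a (k + 1) (k + 3) + a (k + 2) (k + 6) + a (k + 4) (k + 5) = 0)
    (hB : ∀ i, 2 * (a (i + 2) (i + 4) * a (i + 5) (i + 6) - a (i + 2) (i + 5) * a (i + 4) (i + 6)
      + a (i + 2) (i + 6) * a (i + 4) (i + 5)) = -c)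
    (hE : ∀ i d, (d = 2 ∨ d = 4 ∨ d = 5 ∨ d = 6) →
      2 * (a (i + d) i * a (i + 1) (i + 3) - a (i + d) (i + 1) * a i (i + 3)
        + a (i + d) (i + 3) * a i (i + 1)) = b (i + d)) :
    (∑ k, a 0 k * a 0 k = 2 * c) ∧ (∑ k, a 0 k * a k 1 = 0) ∧ (∑ k, a 0 k * a k 2 = 0) ∧
      ∑ k, a 0 k * a k 3 = 0 := by
  have hdiag : ∀ x, a x x = 0 := fun x => by linarith [hskew x x]
  have hB1 := hB 1
  have hB2 := hB 2
  have hB3 := hB 3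
  have hB5 := hB 5
  have hE06 := hE 0 6 (by decide)
  have hE12 := hE 1 2 (by decide)
  have hE15 := hE 1 5 (by decide)
  have hE24 := hE 2 4 (by decide)
  have hE26 := hE 2 6 (by decide)
  have hE35 := hE 3 5 (by decide)
  have hE42 := hE 4 2 (by decide)
  have hE44 := hE 4 4 (by decide)
  have hE46 := hE 4 6 (by decide)
  have hE55 := hE 5 5 (by decide)
  have hE62 := hE 6 2 (by decide)
  have hE64 := hE 6 4 (by decide)
  have hL0 := hL 0
  have hL1 := hL 1
  have hL2 := hL 2
  have hL3 := hL 3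
  have hL4 := hL 4
  have hL5 := hL 5
  have hL6 := hL 6
  simp only [Fin.reduceAdd, zero_add] at hB1 hB2 hB3 hB5 hL0 hL1 hL2 hL3 hL4 hL5 hL6
  simp only [Fin.reduceAdd, zero_add] at hE06 hE12 hE15 hE24 hE26 hE35 hE42 hE44 hE46 hE55 hE62 hE64
  simp only [Fin.sum_univ_seven, hdiag]
  simp only [hskew 3 0, hskew 4 0, hskew 5 0, hskew 6 0, hskew 2 1, hskew 3 1, hskew 4 1,
    hskew 5 1, hskew 6 1, hskew 3 2, hskew 4 2, hskew 5 2, hskew 6 2, hskew 4 3, hskew 5 3,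
    hskew 6 3]
    at hB1 hB2 hB3 hB5 hL0 hL1 hL2 hL3 hL4 hL5 hL6 ⊢
  simp only [hskew 1 0, hskew 3 0, hskew 4 0, hskew 5 0, hskew 6 0, hskew 3 1, hskew 5 1,
    hskew 6 1, hskew 3 2, hskew 6 2, hskew 6 3, hskew 6 4, hskew 6 5]
    at hE06 hE12 hE15 hE24 hE26 hE35 hE42 hE44 hE46 hE55 hE62 hE64
  refine ⟨?_, ?_, ?_, ?_⟩
  · linear_combination -1/2 * hB1 - 1/2 * hB2 - 1/2 * hB3 - 1/2 * hB5 - a 0 3 * hL1 - a 0 6 * hL2 +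
      a 0 1 * hL3 - a 0 5 * hL4 + a 0 4 * hL5 + a 0 2 * hL6
  · linear_combination 1/4 * hE12 - 1/4 * hE46 + 1/4 * hE55 - 1/4 * hE64 - 1/2 * a 0 3 * hL0 +
      1/2 * a 1 3 * hL1 + 1/2 * a 0 4 * hL2 + 1/2 * a 1 6 * hL2 - 1/2 * a 0 2 * hL4 +
      1/2 * a 1 5 * hL4 + 1/2 * a 0 6 * hL5 - 1/2 * a 1 4 * hL5 - 1/2 * a 0 5 * hL6 -
      1/2 * a 1 2 * hL6
  · linear_combination -1/4 * hE06 + 1/4 * hE15 + 1/4 * hE24 - 1/4 * hE42 - 1/2 * a 0 6 * hL0 -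
      1/2 * a 0 4 * hL1 + 1/2 * a 2 3 * hL1 + 1/2 * a 2 6 * hL2 + 1/2 * a 0 5 * hL3 +
      1/2 * a 1 2 * hL3 + 1/2 * a 0 1 * hL4 + 1/2 * a 2 5 * hL4 - 1/2 * a 0 3 * hL5 -
      1/2 * a 2 4 * hL5
  · linear_combination -1/4 * hE26 - 1/4 * hE35 + 1/4 * hE44 + 1/4 * hE62 + 1/2 * a 0 1 * hL0 -
      a 0 5 * hL2 + 1/2 * a 1 2 * hL2 + 1/2 * a 1 3 * hL3 + a 0 6 * hL4 + 1/2 * a 1 4 * hL4 +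
      a 0 2 * hL5 + 1/2 * a 1 5 * hL5 - a 0 4 * hL6 + 1/2 * a 1 6 * hL6

/-- A skew-symmetric matrix of odd size whose square is scalar vanishes. -/
lemma eq_zero_of_skew_of_sq_scalar {n : ℕ} (hn : Odd n) (M : Matrix (Fin n) (Fin n) ℝ) (c : ℝ)
    (hskew : M.transpose = -M) (hsq : M * M = c • 1) : M = 0 := by
  have hdet : M.det = 0 := by
    have h := M.det_transpose
    rw [hskew, Matrix.det_neg, Fintype.card_fin, hn.neg_one_pow] at h
    linarith
  have hc : c = 0 := by
    have h := congrArg Matrix.det hsq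
    rw [Matrix.det_mul, hdet, Matrix.det_smul, Matrix.det_one, mul_one, mul_zero,
      Fintype.card_fin] at h
    exact eq_zero_of_pow_eq_zero h.symm
  have h : M.transpose * M = 0 := by rw [hskew, neg_mul, hsq, hc, zero_smul, neg_zero]
  rw [← Matrix.conjTranspose_eq_transpose_of_trivial] at h
  exact Matrix.conjTranspose_mul_self_eq_zero.mp h

lemma row_identities (a : Fin 7 → Fin 7 → ℝ) (b : Fin 7 → ℝ) (c : ℝ)
    (hskew : ∀ x y, a x y = -a y x)
    (hL : ∀ k, a (k + 1) (k + 3) + a (k + 2) (k + 6) + a (k + 4) (k + 5) = 0)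
    (hB : ∀ i, 2 * (a (i + 2) (i + 4) * a (i + 5) (i + 6) - a (i + 2) (i + 5) * a (i + 4) (i + 6)
      + a (i + 2) (i + 6) * a (i + 4) (i + 5)) = -c)
    (hE : ∀ i d, (d = 2 ∨ d = 4 ∨ d = 5 ∨ d = 6) →
      2 * (a (i + d) i * a (i + 1) (i + 3) - a (i + d) (i + 1) * a i (i + 3)
        + a (i + d) (i + 3) * a i (i + 1)) = b (i + d)) (i : Fin 7) :
    (∑ k, a i k * a i k = 2 * c) ∧ (∑ k, a i k * a k (i + 1) = 0) ∧
      (∑ k, a i k * a k (i + 2) = 0) ∧ ∑ k, a i k * a k (i + 3) = 0 := by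
  have h := row_zero_identities (fun x y => a (x + i) (y + i)) (fun x => b (x + i)) c
    (fun x y => hskew _ _)
    (fun k => by simpa only [add_right_comm k _ i] using hL (k + i))
    (fun k => by simpa only [add_right_comm k _ i] using hB (k + i))
    (fun k d hd => by simpa only [add_right_comm k _ i] using hE (k + i) d hd)
  simp only [zero_add] at h
  have hshift : ∀ f : Fin 7 → ℝ, ∑ k, f (k + i) = ∑ k, f k := Equiv.sum_comp (Equiv.addRight i)
  rw [hshift fun k => a i k * a i k, hshift fun k => a i k * a k (1 + i),
    hshift fun k => a i k * a k (2 + i), hshift fun k => a i k * a k (3 + i)] at h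
  simpa only [add_comm i] using h

/-- if α ∈ Λ²₁₄ and the Λ⁴₂₇-part of α∧α vanishes, i.e.
α∧α = c·Φ + β∧ω for some c ∈ ℝ and 1-form β, then α = 0. -/
theorem lambda14_wedge_square_27_part (α : (Fin 2 → Fin 7) → ℝ)
    (hα : IsForm α) (h14 : Lω α = α)
    (h : ∃ (c : ℝ) (β : (Fin 1 → Fin 7) → ℝ), wedge α α = c • Φ + wedge β ω) :
    α = 0 := by
  obtain ⟨c, β, h⟩ := h
  have hskew := hα.swap
  have hB : ∀ i : Fin 7, 2 * (α ![i + 2, i + 4] * α ![i + 5, i + 6]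
      - α ![i + 2, i + 5] * α ![i + 4, i + 6] + α ![i + 2, i + 6] * α ![i + 4, i + 5]) = -c := by
    intro i
    obtain ⟨h1, h2, h3, h4, h5⟩ := ω_block i
    rw [← wedge_self_apply hα, h, Pi.add_apply, Pi.smul_apply,
      wedge_one_three_apply β ω_isForm, h1, h2, h3, h4, h5, smul_eq_mul]
    ring
  have hE : ∀ i d : Fin 7, (d = 2 ∨ d = 4 ∨ d = 5 ∨ d = 6) →
      2 * (α ![i + d, i] * α ![i + 1, i + 3] - α ![i + d, i + 1] * α ![i, i + 3]
        + α ![i + d, i + 3] * α ![i, i + 1]) = β ![i + d] := by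
    intro i d hd
    obtain ⟨h1, h2, h3, h4⟩ := ω_off_line i d hd
    rw [← wedge_self_apply hα, h, Pi.add_apply, Pi.smul_apply,
      wedge_one_three_apply β ω_isForm, ω_line, h1, h2, h3, h4, smul_eq_mul]
    ring
  have hrow := row_identities (fun x y => α ![x, y]) (fun x => β ![x]) c hskew
    (contraction_eq_zero hα h14) hB hE
  have hsymm : ∀ i j, ∑ k, α ![i, k] * α ![k, j] = ∑ k, α ![j, k] * α ![k, i] := fun i j =>
    Finset.sum_congr rfl fun k _ => by rw [hskew i k, hskew k j]; ring
  have hM : (Matrix.of fun i j => α ![i, j]) = 0 := by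
    refine eq_zero_of_skew_of_sq_scalar (by decide) _ (-(2 * c)) ?_ ?_
    · ext i j
      exact hskew j i
    · ext i j
      rw [Matrix.mul_apply, Matrix.smul_apply, Matrix.one_apply]
      simp only [Matrix.of_apply]
      have hcases : ∀ i j : Fin 7, i = j ∨ i ≠ j ∧ (j = i + 1 ∨ j = i + 2 ∨ j = i + 3 ∨
          i = j + 1 ∨ i = j + 2 ∨ i = j + 3) := by decide
      rcases hcases i j with rfl | ⟨hne, hj⟩
      · rw [if_pos rfl, smul_eq_mul, mul_one, ← (hrow i).1, ← Finset.sum_neg_distrib]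
        exact Finset.sum_congr rfl fun k _ => by rw [hskew k i]; ring
      · rw [if_neg hne, smul_zero]
        rcases hj with rfl | rfl | rfl | rfl | rfl | rfl
        · exact (hrow i).2.1
        · exact (hrow i).2.2.1
        · exact (hrow i).2.2.2
        · exact (hsymm _ _).trans (hrow j).2.1
        · exact (hsymm _ _).trans (hrow j).2.2.1
        · exact (hsymm _ _).trans (hrow j).2.2.2
  funext v
  have hv : v = ![v 0, v 1] := by funext i; fin_cases i <;> rfl
  rw [hv]
  exact congrFun (congrFun hM (v 0)) (v 1)
end
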